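/- Let 2 < p < ∞ and m ≥ 1. There exists a positive integer N, depending only on p and m, such that for every subset A ⊂ ℕ of cardinality m and every x in the linear span of {h_i^{(p)} : i ∈ A} in L_p[0,1], every XGA residual sequence (x_n)_{n≥0} for the dictionary {h_i^{(p)} : i ∈ A} starting at x satisfies x_N = 0. -/

import Mathlib

open MeasureTheory

/-- The Haar functions on `[0,1]` (extended by `0` to all of `ℝ`): `haarFn 0` is the
indicator of `[0,1)` (i.e. `h₀ ≡ 1` on `[0,1]` up to the single point `1`), and for
`i = 2^n + k` with `0 ≤ k < 2^n` (so that `n = Nat.log 2 i`), `haarFn i` is `1` on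
`[k/2^n, (2k+1)/2^(n+1))`, `-1` on `[(2k+1)/2^(n+1), (k+1)/2^n)` and `0` elsewhere. -/
noncomputable def haarFn (i : ℕ) : ℝ → ℝ :=
  if i = 0 then Set.indicator (Set.Ico (0 : ℝ) 1) 1
  else
    let n := Nat.log 2 i
    let k := i - 2 ^ n
    fun t =>
      Set.indicator (Set.Ico ((k : ℝ) / 2 ^ n) ((2 * (k : ℝ) + 1) / 2 ^ (n + 1))) 1 t -
        Set.indicator (Set.Ico ((2 * (k : ℝ) + 1) / 2 ^ (n + 1)) (((k : ℝ) + 1) / 2 ^ n)) 1 t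

/-- The `L_p[0,1]` norm of a function `f : ℝ → ℝ`. -/
noncomputable def pnorm (p : ℝ) (f : ℝ → ℝ) : ℝ :=
  (eLpNorm f (ENNReal.ofReal p) (volume.restrict (Set.Ico (0 : ℝ) 1))).toReal

/-- The `L_p`-normalized Haar function `h_i^{(p)} = h_i / ‖h_i‖_p`. -/
noncomputable def haarFnP (p : ℝ) (i : ℕ) : ℝ → ℝ :=
  fun t => haarFn i t / pnorm p (haarFn i)

/-- The norming functional of a nonzero `y ∈ L_p[0,1]` applied to `g`:
`F_y(g) = ‖y‖_p^{1−p} ∫₀¹ sign(y(t)) |y(t)|^{p−1} g(t) dt`. -/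
noncomputable def normingF (p : ℝ) (y g : ℝ → ℝ) : ℝ :=
  pnorm p y ^ (1 - p) *
    ∫ t in Set.Ico (0 : ℝ) 1, Real.sign (y t) * |y t| ^ (p - 1) * g t


/-- Two-sided second order estimate for `s ↦ |1 + s| ^ p` at `0`. -/
lemma exists_bounds_abs_one_add_rpow {p : ℝ} (hp : 2 < p) :
    ∃ κ > 0, ∃ C > 0, ∀ s : ℝ,
      κ * (s ^ 2 + |s| ^ p) ≤ |1 + s| ^ p - 1 - p * s ∧
        |1 + s| ^ p - 1 - p * s ≤ C * (s ^ 2 + |s| ^ p) := by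
  have hadd : ∀ a b : ℝ, |a + b| ^ p ≤ 2 ^ p * (|a| ^ p + |b| ^ p) := by
    intro a b
    have h1 : |a + b| ≤ 2 * max |a| |b| := by
      have := abs_add_le a b
      linarith [le_max_left |a| |b|, le_max_right |a| |b|]
    have h2 : |a + b| ^ p ≤ (2 * max |a| |b|) ^ p :=
      Real.rpow_le_rpow (abs_nonneg _) h1 (by linarith)
    rw [Real.mul_rpow (by norm_num) (le_max_of_le_left (abs_nonneg _))] at h2
    refine h2.trans (mul_le_mul_of_nonneg_left ?_ (by positivity))
    have ha : 0 ≤ |a| ^ p := by positivity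
    have hb : 0 ≤ |b| ^ p := by positivity
    rcases max_choice |a| |b| with h | h <;> rw [h] <;> linarith
  have h2p : (0 : ℝ) < 2 ^ p := by positivity
  refine ⟨1 / (2 + 2 ^ p * (3 + p)), by positivity,
    2 ^ p * (1 + 16 * p ^ 2) + 4 * p ^ 2 + 8 * p ^ 2, by positivity, fun s => ⟨?_, ?_⟩⟩
  · have hsq : p / 2 * s ^ 2 ≤ |1 + s| ^ p - 1 - p * s := by
      have hb := one_add_mul_self_le_rpow_one_add
        (show -1 ≤ 2 * s + s ^ 2 by nlinarith [sq_nonneg (1 + s)])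
        (show 1 ≤ p / 2 by linarith)
      have he : (1 + (2 * s + s ^ 2)) ^ (p / 2) = |1 + s| ^ p := by
        rw [show 1 + (2 * s + s ^ 2) = |1 + s| ^ (2 : ℝ) by
          rw [Real.rpow_two, sq_abs]; ring, ← Real.rpow_mul (abs_nonneg _)]
        congr 1; ring
      rw [he] at hb
      linarith
    set G := |1 + s| ^ p - 1 - p * s with hG
    have hsG : s ^ 2 ≤ G := by nlinarith [sq_nonneg s]
    have hG0 : 0 ≤ G := le_trans (sq_nonneg s) hsG
    have hpG : |s| ^ p ≤ (1 + 2 ^ p * (3 + p)) * G := by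
      rcases le_total |s| 1 with h | h
      · have h1 : |s| ^ p ≤ |s| ^ (2 : ℝ) :=
          Real.rpow_le_rpow_of_exponent_ge' (abs_nonneg _) h (by norm_num) hp.le
        rw [Real.rpow_two, sq_abs] at h1
        have : 0 ≤ 2 ^ p * (3 + p) * G := by positivity
        nlinarith
      · have h1 := hadd (1 + s) (-1)
        rw [show 1 + s + -1 = s by ring, abs_neg, abs_one, Real.one_rpow] at h1
        have h2 : |s| ≤ s ^ 2 := by rw [← sq_abs]; nlinarith
        have h3 : |1 + s| ^ p + 1 ≤ (3 + p) * G := by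
          have : p * s ≤ p * s ^ 2 :=
            mul_le_mul_of_nonneg_left ((le_abs_self s).trans h2) (by linarith)
          nlinarith
        calc |s| ^ p ≤ 2 ^ p * (|1 + s| ^ p + 1) := h1
          _ ≤ 2 ^ p * ((3 + p) * G) := by gcongr
          _ ≤ _ := by linarith
    rw [one_div, inv_mul_le_iff₀ (by positivity)]
    linarith
  · have hsp : 0 ≤ |s| ^ p := by positivity
    have hs2 := sq_nonneg s
    rcases le_total |s| (1 / (4 * p)) with h | h
    · have hs4 : |s| * (4 * p) ≤ 1 := by rwa [le_div_iff₀ (by positivity)] at h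
      have hs : |s| ≤ 1 / 8 := by nlinarith [abs_nonneg s]
      obtain ⟨hl, hu⟩ := abs_le.1 hs
      have hpos : 0 < 1 + s := by linarith
      set t := p * s / (1 + s) with ht
      have hts : t * (1 + s) = p * s := by rw [ht]; field_simp
      have htabs : |t| * (1 + s) = p * |s| := by
        rw [← abs_of_pos hpos, ← abs_mul, hts, abs_mul, abs_of_pos (by linarith : 0 < p)]
      have ht2 : |t| ≤ 2 * p * |s| := by nlinarith [abs_nonneg t]
      have htl : |t| ≤ 1 / 2 := by nlinarith
      have htu : t ≤ p * s := by
        have : t = p * s - p * s ^ 2 / (1 + s) := by rw [ht]; field_simp; ring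
        have h0 : 0 ≤ p * s ^ 2 / (1 + s) := by positivity
        linarith
      have hb := one_add_mul_self_le_rpow_one_add
        (show -1 ≤ -(s / (1 + s)) by
          rw [neg_le_neg_iff, div_le_one hpos]; linarith) (show 1 ≤ p by linarith)
      rw [show 1 + -(s / (1 + s)) = (1 + s)⁻¹ by field_simp; ring, Real.inv_rpow hpos.le,
        show 1 + p * -(s / (1 + s)) = 1 - t by rw [ht]; ring] at hb
      have hX : 0 < (1 + s) ^ p := by positivity
      have hX1 : (1 - t) * (1 + s) ^ p ≤ 1 := by
        rwa [← le_div_iff₀ hX, one_div]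
      obtain ⟨htl1, htl2⟩ := abs_le.1 htl
      have hX2 : (1 + s) ^ p ≤ 1 + t + 2 * t ^ 2 := by
        by_contra! hcon
        nlinarith [mul_lt_mul_of_pos_left hcon (by linarith : 0 < 1 - t),
          mul_nonneg (sq_nonneg t) (by linarith : 0 ≤ 1 - 2 * t)]
      have ht4 : t ^ 2 ≤ 4 * p ^ 2 * s ^ 2 := by
        rw [← sq_abs t, ← sq_abs s]
        nlinarith [abs_nonneg t, abs_nonneg s]
      rw [abs_of_pos hpos]
      have : 0 ≤ (2 ^ p * (1 + 16 * p ^ 2) + 4 * p ^ 2) * (s ^ 2 + |s| ^ p) := by positivity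
      have : 0 ≤ 8 * p ^ 2 * |s| ^ p := by positivity
      nlinarith
    · have hs4 : 1 ≤ |s| * (4 * p) := by rwa [div_le_iff₀ (by positivity)] at h
      have h1 : 1 ≤ 16 * p ^ 2 * s ^ 2 := by
        rw [← sq_abs s]; nlinarith
      have h2 : -(p * s) ≤ 4 * p ^ 2 * s ^ 2 := by
        have : -(p * s) ≤ p * |s| := by nlinarith [neg_abs_le s]
        have : p * |s| * 1 ≤ p * |s| * (|s| * (4 * p)) := by gcongr
        rw [← sq_abs s]; nlinarith
      have h3 := hadd 1 s
      rw [abs_one, Real.one_rpow] at h3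
      have h4 : 2 ^ p * (1 + |s| ^ p) ≤ 2 ^ p * ((1 + 16 * p ^ 2) * (s ^ 2 + |s| ^ p)) := by
        refine mul_le_mul_of_nonneg_left ?_ h2p.le
        have : 0 ≤ 16 * p ^ 2 * |s| ^ p := by positivity
        nlinarith
      have : 0 ≤ 4 * p ^ 2 * |s| ^ p := by positivity
      have : 0 ≤ 8 * p ^ 2 * (s ^ 2 + |s| ^ p) := by positivity
      nlinarith

/-- Two-sided second order estimate for `s ↦ |c + s| ^ p` at `0`. -/
lemma exists_bounds_abs_add_rpow {p : ℝ} (hp : 2 < p) :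
    ∃ κ > 0, ∃ C > 0, ∀ c s : ℝ,
      κ * (|c| ^ (p - 2) * s ^ 2 + |s| ^ p) ≤
          |c + s| ^ p - |c| ^ p - p * (|c| ^ (p - 2) * c) * s ∧
        |c + s| ^ p - |c| ^ p - p * (|c| ^ (p - 2) * c) * s ≤
          C * (|c| ^ (p - 2) * s ^ 2 + |s| ^ p) := by
  obtain ⟨κ, hκ, C, hC, h⟩ := exists_bounds_abs_one_add_rpow hp
  refine ⟨min κ 1, by positivity, max C 1, by positivity, fun c s => ?_⟩
  have hmin : min κ 1 ≤ κ := min_le_left _ _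
  have hmax : C ≤ max C 1 := le_max_left _ _
  rcases eq_or_ne c 0 with rfl | hc
  · have hs : 0 ≤ |s| ^ p := by positivity
    simp only [abs_zero, Real.zero_rpow (show p - 2 ≠ 0 by linarith),
      Real.zero_rpow (show p ≠ 0 by linarith), zero_add, zero_mul, mul_zero, sub_zero]
    exact ⟨mul_le_of_le_one_left hs (min_le_right _ _),
      le_mul_of_one_le_left hs (le_max_right _ _)⟩
  · have hc' : 0 < |c| := abs_pos.2 hc
    have hcp : |c| ^ p = |c| ^ (p - 2) * c ^ 2 := by
      rw [← sq_abs c, ← Real.rpow_two, ← Real.rpow_add hc']; congr 1; ring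
    have e1 : |c + s| ^ p = |c| ^ p * |1 + s / c| ^ p := by
      rw [← Real.mul_rpow hc'.le (abs_nonneg _), ← abs_mul]; congr 2; field_simp
    have e2 : |s| ^ p = |c| ^ p * |s / c| ^ p := by
      rw [← Real.mul_rpow hc'.le (abs_nonneg _), ← abs_mul]; congr 2; field_simp
    have e3 : |c| ^ (p - 2) * s ^ 2 = |c| ^ p * (s / c) ^ 2 := by
      rw [hcp]; field_simp
    have e4 : p * (|c| ^ (p - 2) * c) * s = |c| ^ p * (p * (s / c)) := by
      rw [hcp]; field_simp
    obtain ⟨hl, hu⟩ := h (s / c)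
    have hP : 0 ≤ |c| ^ p := by positivity
    have hQ : 0 ≤ (s / c) ^ 2 + |s / c| ^ p := by positivity
    rw [e1, e2, e3, e4, ← mul_add, show |c| ^ p * |1 + s / c| ^ p - |c| ^ p -
      |c| ^ p * (p * (s / c)) = |c| ^ p * (|1 + s / c| ^ p - 1 - p * (s / c)) by ring,
      mul_left_comm, mul_left_comm (max C 1)]
    exact ⟨mul_le_mul_of_nonneg_left ((mul_le_mul_of_nonneg_right hmin hQ).trans hl) hP,
      mul_le_mul_of_nonneg_left (hu.trans (mul_le_mul_of_nonneg_right hmax hQ)) hP⟩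

lemma dyadic_le_iff {n l k a : ℕ} (hl : l ≤ n) {t : ℝ} (h1 : (k : ℝ) / 2 ^ n ≤ t)
    (h2 : t < ((k : ℝ) + 1) / 2 ^ n) : (a : ℝ) / 2 ^ l ≤ t ↔ a * 2 ^ (n - l) ≤ k := by
  have e : (a : ℝ) / 2 ^ l = ((a * 2 ^ (n - l) : ℕ) : ℝ) / 2 ^ n := by
    obtain ⟨d, rfl⟩ := Nat.exists_eq_add_of_le hl
    rw [Nat.add_sub_cancel_left, pow_add]
    push_cast
    field_simp
  rw [e]
  constructor
  · intro h
    have h3 := h.trans_lt h2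
    rw [div_lt_div_iff_of_pos_right (by positivity)] at h3
    exact_mod_cast Nat.lt_succ_iff.1 (by exact_mod_cast h3)
  · intro h
    refine le_trans ?_ h1
    gcongr

lemma haarFn_zero_apply (t : ℝ) : haarFn 0 t = if 0 ≤ t ∧ t < 1 then 1 else 0 := by
  simp [haarFn, Set.indicator_apply]

lemma haarFn_of_ne_zero {i : ℕ} (hi : i ≠ 0) :
    ∃ n k : ℕ, i = 2 ^ n + k ∧ k < 2 ^ n ∧ haarFn i = fun t =>
      Set.indicator (Set.Ico ((k : ℝ) / 2 ^ n) ((2 * (k : ℝ) + 1) / 2 ^ (n + 1))) 1 t -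
        Set.indicator (Set.Ico ((2 * (k : ℝ) + 1) / 2 ^ (n + 1)) (((k : ℝ) + 1) / 2 ^ n)) 1 t := by
  have h1 := Nat.pow_log_le_self 2 hi
  have h2 := Nat.lt_pow_succ_log_self one_lt_two i
  rw [pow_succ] at h2
  refine ⟨Nat.log 2 i, i - 2 ^ Nat.log 2 i, by omega, by omega, ?_⟩
  simp [haarFn, hi]

lemma haarFn_mid (n k : ℕ) : (k : ℝ) / 2 ^ n < (2 * (k : ℝ) + 1) / 2 ^ (n + 1) ∧
    (2 * (k : ℝ) + 1) / 2 ^ (n + 1) < ((k : ℝ) + 1) / 2 ^ n := by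
  constructor
  · rw [div_lt_div_iff₀ (by positivity) (by positivity), pow_succ]
    nlinarith [show (0 : ℝ) < 2 ^ n by positivity]
  · rw [div_lt_div_iff₀ (by positivity) (by positivity), pow_succ]
    nlinarith [show (0 : ℝ) < 2 ^ n by positivity]

lemma mem_Ico_of_haar_ne_zero {n k : ℕ} {t : ℝ}
    (h : Set.indicator (Set.Ico ((k : ℝ) / 2 ^ n) ((2 * (k : ℝ) + 1) / 2 ^ (n + 1))) 1 t -
      Set.indicator (Set.Ico ((2 * (k : ℝ) + 1) / 2 ^ (n + 1)) (((k : ℝ) + 1) / 2 ^ n))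
        (1 : ℝ → ℝ) t ≠ 0) :
    (k : ℝ) / 2 ^ n ≤ t ∧ t < ((k : ℝ) + 1) / 2 ^ n := by
  obtain ⟨m1, m2⟩ := haarFn_mid n k
  by_contra hcon
  apply h
  rw [Set.indicator_of_notMem, Set.indicator_of_notMem, sub_zero]
  · exact fun ht => hcon ⟨m1.le.trans ht.1, ht.2⟩
  · exact fun ht => hcon ⟨ht.1, ht.2.trans m2⟩

/-- A Haar function is constant on the support of every later one. -/
lemma haarFn_eq_of_lt {i j : ℕ} (hij : i < j) {s t : ℝ} (hs : haarFn j s ≠ 0)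
    (ht : haarFn j t ≠ 0) : haarFn i s = haarFn i t := by
  obtain ⟨n, k, hj, hk, he⟩ := haarFn_of_ne_zero (show j ≠ 0 by omega)
  rw [he] at hs ht
  obtain ⟨hs1, hs2⟩ := mem_Ico_of_haar_ne_zero hs
  obtain ⟨ht1, ht2⟩ := mem_Ico_of_haar_ne_zero ht
  rcases eq_or_ne i 0 with rfl | hi
  · have hb : ((k : ℝ) + 1) / 2 ^ n ≤ 1 := by
      rw [div_le_one (by positivity)]
      exact_mod_cast hk
    have h0 : (0 : ℝ) ≤ (k : ℝ) / 2 ^ n := by positivity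
    rw [haarFn_zero_apply, haarFn_zero_apply, if_pos ⟨by linarith, by linarith⟩,
      if_pos ⟨by linarith, by linarith⟩]
  obtain ⟨n', k', hi', hk', he'⟩ := haarFn_of_ne_zero hi
  rw [he']
  have hnn : n' ≤ n := by
    by_contra! hlt
    have : 2 ^ (n + 1) ≤ 2 ^ n' := Nat.pow_le_pow_right (by norm_num) hlt
    rw [pow_succ] at this
    omega
  obtain ⟨m1, m2⟩ := haarFn_mid n' k'
  rcases hnn.lt_or_eq with hlt | rfl
  · have key : ∀ l ≤ n, ∀ a : ℕ, (a : ℝ) / 2 ^ l ≤ s ↔ (a : ℝ) / 2 ^ l ≤ t := fun l hl a => by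
      rw [dyadic_le_iff hl hs1 hs2, dyadic_le_iff hl ht1 ht2]
    have k1 := key n' hnn k'
    have k2 := key (n' + 1) hlt (2 * k' + 1)
    have k3 := key n' hnn (k' + 1)
    push_cast at k2 k3
    simp only [Set.indicator_apply, Set.mem_Ico, ← not_le, k1, k2, k3, Pi.one_apply]
  · have hle : ((k' : ℝ) + 1) / 2 ^ n' ≤ (k : ℝ) / 2 ^ n' := by
      have : k' + 1 ≤ k := by omega
      gcongr
      exact_mod_cast this
    have hout : ∀ u : ℝ, (k : ℝ) / 2 ^ n' ≤ u →
        Set.indicator (Set.Ico ((k' : ℝ) / 2 ^ n') ((2 * (k' : ℝ) + 1) / 2 ^ (n' + 1))) 1 u -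
        Set.indicator (Set.Ico ((2 * (k' : ℝ) + 1) / 2 ^ (n' + 1)) (((k' : ℝ) + 1) / 2 ^ n'))
          (1 : ℝ → ℝ) u = 0 := by
      intro u hu
      by_contra hne
      have := (mem_Ico_of_haar_ne_zero hne).2
      linarith
    simp only [hout s hs1, hout t ht1]

lemma haarFn_values (i : ℕ) (t : ℝ) : haarFn i t = 0 ∨ |haarFn i t| = 1 := by
  rcases eq_or_ne i 0 with rfl | hi
  · rw [haarFn_zero_apply]
    split_ifs <;> simp
  · obtain ⟨n, k, -, -, he⟩ := haarFn_of_ne_zero hi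
    rw [he]
    simp only [Set.indicator_apply, Set.mem_Ico]
    split_ifs with h1 h2
    · exact absurd h1.2 (not_lt.2 h2.1)
    all_goals simp

lemma measurable_haarFn (i : ℕ) : Measurable (haarFn i) := by
  rcases eq_or_ne i 0 with rfl | hi
  · simp only [haarFn, if_true]
    exact measurable_one.indicator measurableSet_Ico
  · obtain ⟨n, k, -, -, he⟩ := haarFn_of_ne_zero hi
    rw [he]
    exact (measurable_one.indicator measurableSet_Ico).sub
      (measurable_one.indicator measurableSet_Ico)

lemma support_haarFn_subset (i : ℕ) : Function.support (haarFn i) ⊆ Set.Ico 0 1 := by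
  intro t ht
  rcases eq_or_ne i 0 with rfl | hi
  · rw [Function.mem_support, haarFn_zero_apply] at ht
    by_contra h
    exact ht (if_neg h)
  · obtain ⟨n, k, -, hk, he⟩ := haarFn_of_ne_zero hi
    rw [Function.mem_support, he] at ht
    obtain ⟨h1, h2⟩ := mem_Ico_of_haar_ne_zero ht
    have hb : ((k : ℝ) + 1) / 2 ^ n ≤ 1 := by
      rw [div_le_one (by positivity)]
      exact_mod_cast hk
    have h0 : (0 : ℝ) ≤ (k : ℝ) / 2 ^ n := by positivity
    exact ⟨by linarith, by linarith⟩

lemma integral_haarFn {i : ℕ} (hi : i ≠ 0) : ∫ t in Set.Ico (0 : ℝ) 1, haarFn i t = 0 := by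
  rw [setIntegral_eq_integral_of_forall_compl_eq_zero fun t ht =>
    Function.notMem_support.1 fun h => ht (support_haarFn_subset i h)]
  obtain ⟨n, k, -, -, he⟩ := haarFn_of_ne_zero hi
  obtain ⟨m1, m2⟩ := haarFn_mid n k
  have hint : ∀ a b : ℝ, Integrable (Set.indicator (Set.Ico a b) (1 : ℝ → ℝ)) := fun a b =>
    (integrable_indicator_iff measurableSet_Ico).2 (integrableOn_const (by simp))
  rw [he, integral_sub (hint _ _) (hint _ _), integral_indicator_one measurableSet_Ico,
    integral_indicator_one measurableSet_Ico, Real.volume_real_Ico_of_le m1.le,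
    Real.volume_real_Ico_of_le m2.le, pow_succ]
  field_simp
  ring

/-- The measure of the support of the Haar function `haarFn i`. -/
noncomputable def haarMass (i : ℕ) : ℝ :=
  (volume.restrict (Set.Ico (0 : ℝ) 1)).real (Function.support (haarFn i))

lemma haarMass_pos (i : ℕ) : 0 < haarMass i := by
  have hsub : ∃ a b : ℝ, a < b ∧ Set.Ico a b ⊆ Function.support (haarFn i) := by
    rcases eq_or_ne i 0 with rfl | hi
    · refine ⟨0, 1, one_pos, fun t ht => ?_⟩
      rw [Function.mem_support, haarFn_zero_apply, if_pos ⟨ht.1, ht.2⟩]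
      exact one_ne_zero
    · obtain ⟨n, k, -, -, he⟩ := haarFn_of_ne_zero hi
      refine ⟨_, _, (haarFn_mid n k).1, fun t ht => ?_⟩
      rw [Function.mem_support, he]
      simp only
      rw [Set.indicator_of_mem ht, Set.indicator_of_notMem]
      · simp
      · exact fun h => not_lt.2 h.1 ht.2
  obtain ⟨a, b, hab, hsub⟩ := hsub
  have hs : Set.Ico a b ⊆ Function.support (haarFn i) ∩ Set.Ico 0 1 :=
    Set.subset_inter hsub (hsub.trans (support_haarFn_subset i))
  unfold haarMass
  rw [measureReal_restrict_apply (measurableSet_support (measurable_haarFn i))]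
  refine lt_of_lt_of_le ?_ (measureReal_mono hs
    (measure_ne_top_of_subset Set.inter_subset_right (by simp)))
  rw [Real.volume_real_Ico_of_le hab.le]
  linarith

lemma haarMass_le {i j : ℕ} (h : Function.support (haarFn j) ⊆ Function.support (haarFn i)) :
    haarMass j ≤ haarMass i :=
  measureReal_mono h

lemma integral_abs_haarFn_rpow (i : ℕ) {q : ℝ} (hq : 0 < q) :
    ∫ t in Set.Ico (0 : ℝ) 1, |haarFn i t| ^ q = haarMass i := by
  have : (fun t => |haarFn i t| ^ q) = Set.indicator (Function.support (haarFn i)) 1 := by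
    ext t
    rcases haarFn_values i t with h | h
    · rw [Set.indicator_of_notMem (by simpa using h), h, abs_zero, Real.zero_rpow hq.ne']
    · rw [Set.indicator_of_mem (by rw [Function.mem_support]; intro h'; simp [h'] at h), h,
        Real.one_rpow, Pi.one_apply]
  rw [this, integral_indicator_one (measurableSet_support (measurable_haarFn i))]
  rfl

/-- The function `f` is a simple function. -/
def IsSimple (f : ℝ → ℝ) : Prop := ∃ F : SimpleFunc ℝ ℝ, ⇑F = f

namespace IsSimple

variable {f g : ℝ → ℝ}

lemma const (c : ℝ) : IsSimple fun _ => c := ⟨SimpleFunc.const ℝ c, rfl⟩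

lemma comp (hf : IsSimple f) (φ : ℝ → ℝ) : IsSimple fun t => φ (f t) := by
  obtain ⟨F, rfl⟩ := hf
  exact ⟨F.map φ, rfl⟩

lemma comp₂ (hf : IsSimple f) (hg : IsSimple g) (φ : ℝ → ℝ → ℝ) :
    IsSimple fun t => φ (f t) (g t) := by
  obtain ⟨F, rfl⟩ := hf
  obtain ⟨G, rfl⟩ := hg
  exact ⟨(F.pair G).map fun q => φ q.1 q.2, rfl⟩

lemma add (hf : IsSimple f) (hg : IsSimple g) : IsSimple fun t => f t + g t :=
  hf.comp₂ hg (· + ·)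

lemma sub (hf : IsSimple f) (hg : IsSimple g) : IsSimple fun t => f t - g t :=
  hf.comp₂ hg (· - ·)

lemma mul (hf : IsSimple f) (hg : IsSimple g) : IsSimple fun t => f t * g t :=
  hf.comp₂ hg (· * ·)

lemma const_mul (hf : IsSimple f) (c : ℝ) : IsSimple fun t => c * f t :=
  hf.comp (c * ·)

lemma abs_rpow (hf : IsSimple f) (q : ℝ) : IsSimple fun t => |f t| ^ q :=
  hf.comp fun u => |u| ^ q

lemma sum {ι : Type*} {F : ι → ℝ → ℝ} (J : Finset ι) (hF : ∀ i ∈ J, IsSimple (F i)) :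
    IsSimple fun t => ∑ i ∈ J, F i t := by
  classical
  induction J using Finset.induction_on with
  | empty => simpa using const 0
  | insert i J hi ih =>
    simp only [Finset.sum_insert hi]
    exact (hF i (Finset.mem_insert_self _ _)).add
      (ih fun j hj => hF j (Finset.mem_insert_of_mem hj))

lemma integrable (hf : IsSimple f) (μ : Measure ℝ) [IsFiniteMeasure μ] : Integrable f μ := by
  obtain ⟨F, rfl⟩ := hf
  exact F.integrable_of_isFiniteMeasure

lemma memLp (hf : IsSimple f) (q : ENNReal) (μ : Measure ℝ) [IsFiniteMeasure μ] :
    MemLp f q μ := by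
  obtain ⟨F, rfl⟩ := hf
  exact F.memLp_of_isFiniteMeasure q μ

end IsSimple

lemma isSimple_haarFn (i : ℕ) : IsSimple (haarFn i) := by
  refine ⟨⟨haarFn i, fun x => measurable_haarFn i (measurableSet_singleton x), ?_⟩, rfl⟩
  refine Set.Finite.subset (Set.toFinite {0, 1, -1}) ?_
  rintro _ ⟨t, rfl⟩
  rcases haarFn_values i t with h | h
  · simp [h]
  · rcases eq_or_eq_neg_of_abs_eq h with h | h <;> simp [h]

lemma isSimple_haarFnP (p : ℝ) (i : ℕ) : IsSimple (haarFnP p i) :=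
  (isSimple_haarFn i).comp (· / pnorm p (haarFn i))

lemma pnorm_nonneg (p : ℝ) (f : ℝ → ℝ) : 0 ≤ pnorm p f := ENNReal.toReal_nonneg

lemma pnorm_rpow {p : ℝ} (hp : 0 < p) {f : ℝ → ℝ} (hf : IsSimple f) :
    pnorm p f ^ p = ∫ t in Set.Ico (0 : ℝ) 1, |f t| ^ p := by
  have hI : 0 ≤ ∫ t in Set.Ico (0 : ℝ) 1, |f t| ^ p :=
    integral_nonneg fun t => Real.rpow_nonneg (abs_nonneg _) _
  rw [pnorm, (hf.memLp (ENNReal.ofReal p) _).eLpNorm_eq_integral_rpow_norm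
    (by simpa using hp) ENNReal.ofReal_ne_top, ENNReal.toReal_ofReal hp.le]
  simp only [Real.norm_eq_abs]
  rw [ENNReal.toReal_ofReal (by positivity), ← Real.rpow_mul hI, inv_mul_cancel₀ hp.ne',
    Real.rpow_one]

lemma pnorm_add_le {p : ℝ} (hp : 1 ≤ p) {f g : ℝ → ℝ} (hf : IsSimple f) (hg : IsSimple g) :
    pnorm p (fun t => f t + g t) ≤ pnorm p f + pnorm p g := by
  have hf' := hf.memLp (ENNReal.ofReal p) (volume.restrict (Set.Ico (0 : ℝ) 1))
  have hg' := hg.memLp (ENNReal.ofReal p) (volume.restrict (Set.Ico (0 : ℝ) 1))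
  unfold pnorm
  rw [← ENNReal.toReal_add hf'.eLpNorm_ne_top hg'.eLpNorm_ne_top]
  exact ENNReal.toReal_mono (ENNReal.add_ne_top.2 ⟨hf'.eLpNorm_ne_top, hg'.eLpNorm_ne_top⟩)
    (eLpNorm_add_le hf'.1 hg'.1 (by simpa using ENNReal.ofReal_le_ofReal hp))

lemma pnorm_const_mul (p c : ℝ) (f : ℝ → ℝ) : pnorm p (fun t => c * f t) = |c| * pnorm p f := by
  have : (fun t => c * f t) = c • f := rfl
  unfold pnorm
  rw [this, eLpNorm_const_smul, ENNReal.toReal_mul]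
  simp

lemma pnorm_zero (p : ℝ) : pnorm p (fun _ => 0) = 0 := by
  simpa using pnorm_const_mul p 0 fun _ => 0

lemma pnorm_haarFn {p : ℝ} (hp : 0 < p) (i : ℕ) : pnorm p (haarFn i) = haarMass i ^ p⁻¹ := by
  have h := pnorm_rpow hp (isSimple_haarFn i)
  rw [integral_abs_haarFn_rpow i hp] at h
  rw [← h, ← Real.rpow_mul (pnorm_nonneg _ _), mul_inv_cancel₀ hp.ne', Real.rpow_one]

lemma integral_abs_haarFnP_rpow {p q : ℝ} (hp : 0 < p) (hq : 0 < q) (i : ℕ) :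
    ∫ t in Set.Ico (0 : ℝ) 1, |haarFnP p i t| ^ q = haarMass i ^ (1 - q / p) := by
  have hm := haarMass_pos i
  have : ∀ t, |haarFnP p i t| ^ q = (haarMass i ^ (q / p))⁻¹ * |haarFn i t| ^ q := by
    intro t
    rw [haarFnP, pnorm_haarFn hp, abs_div, Real.div_rpow (abs_nonneg _) (abs_nonneg _),
      abs_of_pos (show 0 < haarMass i ^ p⁻¹ by positivity), ← Real.rpow_mul hm.le,
      inv_mul_eq_div, inv_mul_eq_div]
  simp only [this]
  rw [integral_const_mul, integral_abs_haarFn_rpow i hq, Real.rpow_sub hm, Real.rpow_one,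
    inv_mul_eq_div]

lemma pnorm_haarFnP {p : ℝ} (hp : 0 < p) (i : ℕ) : pnorm p (haarFnP p i) = 1 := by
  have h := pnorm_rpow hp (isSimple_haarFnP p i)
  rw [integral_abs_haarFnP_rpow hp hp, div_self hp.ne', sub_self, Real.rpow_zero] at h
  exact (Real.rpow_left_inj (pnorm_nonneg _ _) zero_le_one hp.ne').1
    (h.trans (Real.one_rpow p).symm)

lemma haarFnP_eq_zero {p : ℝ} {i : ℕ} {t : ℝ} (h : haarFn i t = 0) : haarFnP p i t = 0 := by
  simp [haarFnP, h]

/-- A Haar function other than `haarFn 0` is orthogonal to every function that is constant on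
its support. -/
lemma integral_mul_haarFnP_eq_zero (p : ℝ) {j : ℕ} (hj : j ≠ 0) {g : ℝ → ℝ}
    (hg : ∀ s t, haarFn j s ≠ 0 → haarFn j t ≠ 0 → g s = g t) :
    ∫ t in Set.Ico (0 : ℝ) 1, g t * haarFnP p j t = 0 := by
  obtain ⟨c, hc⟩ : ∃ c, ∀ t, haarFn j t ≠ 0 → g t = c := by
    by_cases h : ∃ s, haarFn j s ≠ 0
    · obtain ⟨s, hs⟩ := h
      exact ⟨g s, fun t ht => hg t s ht hs⟩
    · exact ⟨0, fun t ht => absurd ⟨t, ht⟩ h⟩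
  have : ∀ t, g t * haarFnP p j t = c / pnorm p (haarFn j) * haarFn j t := by
    intro t
    by_cases h : haarFn j t = 0
    · simp [haarFnP, h]
    · rw [hc t h, haarFnP]
      ring
  simp only [this]
  rw [integral_const_mul, integral_haarFn hj, mul_zero]

lemma sum_mul_rpow_le {ι : Type*} (J : Finset ι) {q : ℝ} (hq : 1 ≤ q) (w f : ι → ℝ)
    (hw : ∀ i, 0 ≤ w i) (hf : ∀ i, 0 ≤ f i) :
    (∑ i ∈ J, w i * f i) ^ q ≤ (∑ i ∈ J, w i) ^ (q - 1) * ∑ i ∈ J, w i * f i ^ q := by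
  have h := Real.inner_le_weight_mul_Lp_of_nonneg J hq w f hw hf
  have hq0 : 0 < q := by linarith
  have hW : 0 ≤ ∑ i ∈ J, w i := Finset.sum_nonneg fun i _ => hw i
  have hF : 0 ≤ ∑ i ∈ J, w i * f i ^ q :=
    Finset.sum_nonneg fun i _ => mul_nonneg (hw i) (Real.rpow_nonneg (hf i) _)
  have h' := Real.rpow_le_rpow (Finset.sum_nonneg fun i _ => mul_nonneg (hw i) (hf i)) h hq0.le
  rwa [Real.mul_rpow (by positivity) (by positivity), ← Real.rpow_mul hW, ← Real.rpow_mul hF,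
    inv_mul_cancel₀ hq0.ne', Real.rpow_one, sub_mul, inv_mul_cancel₀ hq0.ne', one_mul] at h'

lemma integral_abs_haarFn_mul_le {p q : ℝ} (hq : 0 < q) (hqp : q ≤ p) {k j : ℕ} (hkj : k < j) :
    ∫ t in Set.Ico (0 : ℝ) 1, |haarFn k t| * |haarFnP p j t| ^ q ≤ haarMass k ^ (1 - q / p) := by
  have hp : 0 < p := by linarith
  by_cases h : ∃ s, haarFn j s ≠ 0 ∧ haarFn k s ≠ 0
  · obtain ⟨s, hs, hs'⟩ := h
    have hsub : Function.support (haarFn j) ⊆ Function.support (haarFn k) := by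
      intro t ht
      rw [Function.mem_support, haarFn_eq_of_lt hkj ht hs]
      exact hs'
    have hexp : 0 ≤ 1 - q / p := by
      rw [sub_nonneg, div_le_one hp]
      exact hqp
    calc ∫ t in Set.Ico (0 : ℝ) 1, |haarFn k t| * |haarFnP p j t| ^ q
        ≤ ∫ t in Set.Ico (0 : ℝ) 1, |haarFnP p j t| ^ q := by
          refine integral_mono ((((isSimple_haarFn k).comp fun u => |u|).mul
            ((isSimple_haarFnP p j).abs_rpow q)).integrable _)
            (((isSimple_haarFnP p j).abs_rpow q).integrable _) fun t => ?_
          refine mul_le_of_le_one_left (by positivity) ?_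
          rcases haarFn_values k t with h | h <;> simp [h]
      _ = haarMass j ^ (1 - q / p) := integral_abs_haarFnP_rpow hp hq j
      _ ≤ _ := Real.rpow_le_rpow (haarMass_pos j).le (haarMass_le hsub) hexp
  · push Not at h
    have h0 : ∀ t, |haarFn k t| * |haarFnP p j t| ^ q = 0 := by
      intro t
      by_cases ht : haarFn j t = 0
      · rw [haarFnP_eq_zero ht, abs_zero, Real.zero_rpow hq.ne', mul_zero]
      · rw [h t ht, abs_zero, zero_mul]
    simp only [h0, integral_zero]
    exact Real.rpow_nonneg (haarMass_pos k).le _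

lemma integral_abs_haarFn_mul_sum_le {ι : Type*} {p q : ℝ} (hq : 1 ≤ q) (hqp : q ≤ p) {k : ℕ}
    (J : Finset ι) (σ : ι → ℕ) (hσ : ∀ j ∈ J, k < σ j) (a : ι → ℝ) :
    ∫ t in Set.Ico (0 : ℝ) 1, |haarFn k t| * |∑ j ∈ J, a j * haarFnP p (σ j) t| ^ q ≤
      (∑ j ∈ J, |a j|) ^ q * haarMass k ^ (1 - q / p) := by
  set τ := ∑ j ∈ J, |a j| with hτ
  have hτ0 : 0 ≤ τ := Finset.sum_nonneg fun _ _ => abs_nonneg _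
  have hw : IsSimple fun t => |haarFn k t| := (isSimple_haarFn k).comp fun u => |u|
  have hz : IsSimple fun t => ∑ j ∈ J, a j * haarFnP p (σ j) t :=
    IsSimple.sum J fun j _ => (isSimple_haarFnP p (σ j)).const_mul (a j)
  have hterm : ∀ j, IsSimple fun t => |a j| * (|haarFn k t| * |haarFnP p (σ j) t| ^ q) :=
    fun j => (hw.mul ((isSimple_haarFnP p (σ j)).abs_rpow q)).const_mul _
  calc ∫ t in Set.Ico (0 : ℝ) 1, |haarFn k t| * |∑ j ∈ J, a j * haarFnP p (σ j) t| ^ q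
      ≤ ∫ t in Set.Ico (0 : ℝ) 1,
          τ ^ (q - 1) * ∑ j ∈ J, |a j| * (|haarFn k t| * |haarFnP p (σ j) t| ^ q) := by
        refine integral_mono ((hw.mul (hz.abs_rpow q)).integrable _)
          (((IsSimple.sum J fun j _ => hterm j).const_mul _).integrable _) fun t => ?_
        have h1 : |∑ j ∈ J, a j * haarFnP p (σ j) t| ^ q ≤
            (∑ j ∈ J, |a j| * |haarFnP p (σ j) t|) ^ q := by
          refine Real.rpow_le_rpow (abs_nonneg _) ?_ (by linarith)
          simpa only [abs_mul] using
            Finset.abs_sum_le_sum_abs (fun j => a j * haarFnP p (σ j) t) J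
        have h2 := sum_mul_rpow_le J hq (fun j => |a j|) (fun j => |haarFnP p (σ j) t|)
          (fun _ => abs_nonneg _) (fun _ => abs_nonneg _)
        calc |haarFn k t| * |∑ j ∈ J, a j * haarFnP p (σ j) t| ^ q
            ≤ |haarFn k t| * (τ ^ (q - 1) * ∑ j ∈ J, |a j| * |haarFnP p (σ j) t| ^ q) :=
              mul_le_mul_of_nonneg_left (h1.trans h2) (abs_nonneg _)
          _ = _ := by
            rw [mul_left_comm, Finset.mul_sum]
            simp only [mul_left_comm |haarFn k t|]
    _ = τ ^ (q - 1) *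
          ∑ j ∈ J, |a j| * ∫ t in Set.Ico (0 : ℝ) 1, |haarFn k t| * |haarFnP p (σ j) t| ^ q := by
        rw [integral_const_mul, integral_finsetSum _ fun j _ => (hterm j).integrable _]
        simp only [integral_const_mul]
    _ ≤ τ ^ (q - 1) * ∑ j ∈ J, |a j| * haarMass k ^ (1 - q / p) := by
        gcongr with j hj
        exact integral_abs_haarFn_mul_le (by linarith) hqp (hσ j hj)
    _ = _ := by
        rw [← Finset.sum_mul, ← mul_assoc, ← hτ,
          ← Real.rpow_add_one' hτ0 (show q - 1 + 1 ≠ 0 by linarith), sub_add_cancel]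


/-- The sum of the absolute values of the coordinates of `a` with index at least `k`. -/
noncomputable def tailSum {m : ℕ} (k : ℕ) (a : Fin m → ℝ) : ℝ :=
  ∑ i with k ≤ i.val, |a i|

lemma tailSum_nonneg {m : ℕ} (k : ℕ) (a : Fin m → ℝ) : 0 ≤ tailSum k a :=
  Finset.sum_nonneg fun _ _ => abs_nonneg _

lemma tailSum_eq_add {m : ℕ} (k : Fin m) (a : Fin m → ℝ) :
    tailSum k a = |a k| + tailSum (k + 1) a := by
  unfold tailSum
  have : (Finset.univ.filter fun i : Fin m => k.val ≤ i.val) =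
      insert k (Finset.univ.filter fun i : Fin m => k.val + 1 ≤ i.val) := by
    ext i
    simp only [Finset.mem_filter, Finset.mem_univ, true_and, Finset.mem_insert, Fin.ext_iff]
    omega
  rw [this, Finset.sum_insert (by simp)]

lemma tailSum_of_le {m k : ℕ} (h : m ≤ k) (a : Fin m → ℝ) : tailSum k a = 0 := by
  unfold tailSum
  rw [Finset.filter_false_of_mem, Finset.sum_empty]
  intro i _
  have := i.isLt
  omega

lemma abs_le_tailSum {m k : ℕ} (a : Fin m → ℝ) {i : Fin m} (h : k ≤ i) : |a i| ≤ tailSum k a :=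
  Finset.single_le_sum (f := fun i => |a i|) (fun _ _ => abs_nonneg _)
    (by simpa using h)

lemma tailSum_update_of_lt {m k : ℕ} (a : Fin m → ℝ) {i : Fin m} (h : i.val < k) (s : ℝ) :
    tailSum k (Function.update a i s) = tailSum k a := by
  refine Finset.sum_congr rfl fun j hj => ?_
  have hj' : k ≤ j.val := by simpa using hj
  rw [Function.update_of_ne]
  rintro rfl
  omega

/-- Some coordinate dominates all the later ones and is comparable to the whole vector. -/
lemma exists_dominant_coord {m : ℕ} (hm : 1 ≤ m) {K : ℝ} (hK : 1 ≤ K) (a : Fin m → ℝ) :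
    ∃ j : Fin m, K * tailSum (j + 1) a ≤ |a j| ∧ tailSum 0 a ≤ (1 + K) ^ m * |a j| := by
  by_contra! hcon
  have key : ∀ k ≤ m, tailSum 0 a ≤ (1 + K) ^ k * tailSum k a := by
    intro k
    induction k with
    | zero => simp
    | succ k ih =>
      intro hk
      have ih := ih (by omega)
      have hT := tailSum_eq_add ⟨k, hk⟩ a
      simp only at hT
      have hn := tailSum_nonneg (k + 1) a
      have hpow : 0 < (1 + K) ^ k := by positivity
      by_cases hdom : K * tailSum (k + 1) a ≤ |a ⟨k, hk⟩|
      · exfalso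
        have h1 := hcon ⟨k, hk⟩ hdom
        have h2 : tailSum k a ≤ (1 + K) * |a ⟨k, hk⟩| := by
          have := abs_nonneg (a ⟨k, hk⟩)
          nlinarith
        have h3 : (1 + K) ^ (k + 1) ≤ (1 + K) ^ m := pow_le_pow_right₀ (by linarith) hk
        have h4 : tailSum 0 a ≤ (1 + K) ^ (k + 1) * |a ⟨k, hk⟩| := by
          calc tailSum 0 a ≤ (1 + K) ^ k * tailSum k a := ih
            _ ≤ (1 + K) ^ k * ((1 + K) * |a ⟨k, hk⟩|) := by gcongr
            _ = _ := by ring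
        have h5 := mul_le_mul_of_nonneg_right h3 (abs_nonneg (a ⟨k, hk⟩))
        linarith
      · push Not at hdom
        calc tailSum 0 a ≤ (1 + K) ^ k * tailSum k a := ih
          _ ≤ (1 + K) ^ k * ((1 + K) * tailSum (k + 1) a) := by
            gcongr
            linarith
          _ = _ := by ring
  have h0 := key m le_rfl
  rw [tailSum_of_le le_rfl, mul_zero] at h0
  have hz : ∀ i, |a i| = 0 := fun i =>
    le_antisymm ((abs_le_tailSum a (Nat.zero_le _)).trans h0) (abs_nonneg _)
  have := hcon ⟨0, hm⟩ (by
    have : tailSum 1 a = 0 := Finset.sum_eq_zero fun i _ => hz i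
    simp [this])
  rw [hz, mul_zero] at this
  linarith

/-- A sequence that changes one coordinate `idx n` at a time, contracts a function `ν` comparable
to the `ℓ₁` norm, and leaves the changed coordinate dominated by the later ones, vanishes within
a number of steps that depends only on the constants involved. -/
theorem exists_bound_eq_zero_of_contracting (m : ℕ) {B K ρ : ℝ} (hB : 0 < B) (hK : 1 ≤ K)
    (hρ0 : 0 ≤ ρ) (hρ : ρ < 1) :
    ∃ N : ℕ, ∀ (ν : (Fin m → ℝ) → ℝ) (a : ℕ → Fin m → ℝ) (idx : ℕ → Fin m),
      (∀ v, ν v ≤ tailSum 0 v) → (∀ v, tailSum 0 v ≤ B * ν v) →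
      (∀ v i s, ν v ≤ ν (Function.update v i s) + |v i - s|) →
      (∀ n, a (n + 1) = Function.update (a n) (idx n) (a (n + 1) (idx n))) →
      (∀ n, ν (a (n + 1)) ≤ ρ * ν (a n)) →
      (∀ n, |a (n + 1) (idx n)| ≤ K * tailSum (idx n + 1) (a n)) →
      ∃ n ≤ N, a n = 0 := by
  have key : ∀ k ≤ m, ∃ (N : ℕ) (C : ℝ), 0 < C ∧
      ∀ (ν : (Fin m → ℝ) → ℝ) (a : ℕ → Fin m → ℝ) (idx : ℕ → Fin m),
      (∀ v, ν v ≤ tailSum 0 v) → (∀ v, tailSum 0 v ≤ B * ν v) →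
      (∀ v i s, ν v ≤ ν (Function.update v i s) + |v i - s|) →
      (∀ n, a (n + 1) = Function.update (a n) (idx n) (a (n + 1) (idx n))) →
      (∀ n, ν (a (n + 1)) ≤ ρ * ν (a n)) →
      (∀ n, |a (n + 1) (idx n)| ≤ K * tailSum (idx n + 1) (a n)) →
      ∀ n₀, (∃ l, n₀ ≤ l ∧ l < n₀ + N ∧ k ≤ (idx l).val) ∨
        ∃ n, n₀ ≤ n ∧ n ≤ n₀ + N ∧ tailSum 0 (a n) ≤ C * tailSum k (a n₀) := by
    intro k
    induction k with
    | zero =>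
      intro _
      exact ⟨0, 1, one_pos, fun ν a idx _ _ _ _ _ _ n₀ => Or.inr ⟨n₀, le_rfl, le_rfl, by simp⟩⟩
    | succ k ih =>
      intro hk
      obtain ⟨N, C, hC, ih⟩ := ih (by omega)
      obtain ⟨M, hM⟩ := exists_pow_lt_of_lt_one (show 0 < 1 / (2 * B * C) by positivity) hρ
      have hρ1 : 0 < 1 - ρ := by linarith
      refine ⟨N + M + 1 + N, 1 + C * (K + 1) + B * (2 * K) / (1 - ρ), by positivity, ?_⟩
      intro ν a idx h1 h2 h3 h4 h5 h6 n₀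
      have ih := ih ν a idx h1 h2 h3 h4 h5 h6
      rw [or_iff_not_imp_left]
      intro hno
      push Not at hno
      set κ : Fin m := ⟨k, hk⟩ with hκ
      set τ := tailSum (k + 1) (a n₀) with hτ
      have hτ0 : 0 ≤ τ := tailSum_nonneg _ _
      have hτn : ∀ d ≤ N + M + 1 + N, tailSum (k + 1) (a (n₀ + d)) = τ := by
        intro d
        induction d with
        | zero => simp [hτ]
        | succ d ihd =>
          intro hd
          rw [← ihd (by omega), ← add_assoc, h4, tailSum_update_of_lt]
          exact hno _ (by omega) (by omega)
      have hτ' : ∀ n, n₀ ≤ n → n ≤ n₀ + (N + M + 1 + N) → tailSum (k + 1) (a n) = τ := by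
        intro n hn hn'
        obtain ⟨d, rfl⟩ := Nat.exists_eq_add_of_le hn
        exact hτn d (by omega)
      have hTk : ∀ v : Fin m → ℝ, tailSum k v = |v κ| + tailSum (k + 1) v :=
        fun v => tailSum_eq_add κ v
      suffices hS : ∃ n, n₀ ≤ n ∧ n ≤ n₀ + (N + M + 1 + N) ∧
          (tailSum 0 (a n) ≤ τ ∨ tailSum 0 (a n) ≤ C * ((K + 1) * τ) ∨
            tailSum 0 (a n) ≤ B * (2 * K * τ / (1 - ρ))) by
        obtain ⟨n, hn, hn', hS⟩ := hS
        refine ⟨n, hn, hn', ?_⟩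
        have p1 : 0 ≤ C * ((K + 1) * τ) := by positivity
        have p2 : 0 ≤ B * (2 * K * τ / (1 - ρ)) := by positivity
        have : (1 + C * (K + 1) + B * (2 * K) / (1 - ρ)) * τ =
          τ + C * ((K + 1) * τ) + B * (2 * K * τ / (1 - ρ)) := by ring
        rw [this]
        rcases hS with h | h | h <;> linarith
      -- the coordinate `κ` is changed early on, or the vector is already small
      by_cases hex : ∃ l, n₀ ≤ l ∧ l < n₀ + (N + M) ∧ (idx l).val = k
      · obtain ⟨l, hl, hl', hlk⟩ := hex
        have hlκ : idx l = κ := Fin.ext hlk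
        have hb : ∀ d, l + 1 + d ≤ n₀ + (N + M + 1 + N) → |a (l + 1 + d) κ| ≤ K * τ := by
          intro d
          induction d with
          | zero =>
            intro _
            have := h6 l
            rwa [hlκ, hτ' l hl (by omega)] at this
          | succ d ihd =>
            intro hd
            by_cases hi : idx (l + 1 + d) = κ
            · have := h6 (l + 1 + d)
              rwa [hi, hτ' _ (by omega) (by omega)] at this
            · rw [← add_assoc, h4, Function.update_of_ne (Ne.symm hi)]
              exact ihd (by omega)
        rcases ih (l + 1) with ⟨l', hl1, hl2, hl3⟩ | ⟨n, hn, hn', hT⟩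
        · have hl4 := hno l' (by omega) (by omega)
          have hlκ' : idx l' = κ := Fin.ext (by simp only [hκ]; omega)
          obtain ⟨d, rfl⟩ := Nat.exists_eq_add_of_le hl1
          refine ⟨l + 1 + d, by omega, by omega, Or.inr (Or.inr ?_)⟩
          have b1 := hb d (by omega)
          have b2 := hb (d + 1) (by omega)
          have h7 := h3 (a (l + 1 + d)) κ (a (l + 1 + d + 1) κ)
          have h8 := h4 (l + 1 + d)
          rw [hlκ'] at h8
          rw [← h8] at h7
          have h9 := abs_sub (a (l + 1 + d) κ) (a (l + 1 + d + 1) κ)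
          rw [← add_assoc] at b2
          have h10 := h5 (l + 1 + d)
          refine (h2 _).trans (mul_le_mul_of_nonneg_left ?_ hB.le)
          rw [le_div_iff₀ hρ1]
          linarith
        · refine ⟨n, by omega, by omega, Or.inr (Or.inl (hT.trans ?_))⟩
          rw [hTk, hτ' _ (by omega) (by omega)]
          have := hb 0 (by omega)
          rw [add_zero] at this
          gcongr
          linarith
      · push Not at hex
        rcases ih n₀ with ⟨l', hl1, hl2, hl3⟩ | ⟨n, hn, hn', hT⟩
        · exact absurd (le_antisymm (Nat.lt_succ_iff.1 (hno l' hl1 (by omega))) hl3)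
            (hex l' hl1 (by omega))
        · refine ⟨n + M, by omega, by omega, Or.inl ?_⟩
          have hconst : ∀ d ≤ N + M, a (n₀ + d) κ = a n₀ κ := by
            intro d
            induction d with
            | zero => simp
            | succ d ihd =>
              intro hd
              rw [← ihd (by omega), ← add_assoc, h4, Function.update_of_ne]
              intro h
              exact hex (n₀ + d) (by omega) (by omega) (by rw [← h])
          have hgeo : ∀ d, ν (a (n + d)) ≤ ρ ^ d * ν (a n) := by
            intro d
            induction d with
            | zero => simp
            | succ d ihd =>
              calc ν (a (n + (d + 1))) ≤ ρ * ν (a (n + d)) := h5 _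
                _ ≤ ρ * (ρ ^ d * ν (a n)) := by gcongr
                _ = _ := by ring
          have hbk : |a (n + M) κ| = |a n₀ κ| := by
            obtain ⟨d, hd⟩ := Nat.exists_eq_add_of_le (show n₀ ≤ n + M by omega)
            rw [hd, hconst d (by omega)]
          rw [hTk] at hT
          have hρM : B * C * ρ ^ M ≤ 1 / 2 := by
            rw [lt_div_iff₀ (by positivity)] at hM
            linarith
          have hsmall : tailSum 0 (a (n + M)) ≤ 1 / 2 * (|a n₀ κ| + τ) := by
            calc tailSum 0 (a (n + M)) ≤ B * ν (a (n + M)) := h2 _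
              _ ≤ B * (ρ ^ M * ν (a n)) := by gcongr; exact hgeo M
              _ ≤ B * (ρ ^ M * (C * (|a n₀ κ| + τ))) := by gcongr; exact (h1 _).trans hT
              _ = B * C * ρ ^ M * (|a n₀ κ| + τ) := by ring
              _ ≤ _ := by gcongr
          have := abs_le_tailSum (k := 0) (a (n + M)) (i := κ) (Nat.zero_le _)
          linarith
  obtain ⟨N, C, hC, h⟩ := key m le_rfl
  refine ⟨N, fun ν a idx h1 h2 h3 h4 h5 h6 => ?_⟩
  rcases h ν a idx h1 h2 h3 h4 h5 h6 0 with ⟨l, _, _, hl⟩ | ⟨n, _, hn, hT⟩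
  · have := (idx l).isLt
    omega
  · rw [tailSum_of_le le_rfl, mul_zero] at hT
    refine ⟨n, by omega, funext fun i => abs_eq_zero.1 (le_antisymm ?_ (abs_nonneg _))⟩
    exact (abs_le_tailSum (a n) (Nat.zero_le _)).trans hT

/-- The greedy algorithm for a norm on `ℝ^m` in which suppressing a coordinate that dominates the
later ones decreases the norm substantially terminates within a bounded number of steps. -/
theorem exists_bound_greedy_eq_zero {m : ℕ} (hm : 1 ≤ m) {K κ p : ℝ} (hK : 1 ≤ K) (hκ : 0 < κ)
    (hκ1 : κ ≤ 1) (hp : 0 < p) :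
    ∃ N : ℕ, ∀ (ν : (Fin m → ℝ) → ℝ) (a : ℕ → Fin m → ℝ) (idx : ℕ → Fin m),
      (∀ v, 0 ≤ ν v) → (∀ v, ν v ≤ tailSum 0 v) →
      (∀ v i s, ν v ≤ ν (Function.update v i s) + |v i - s|) →
      (∀ v k, K * tailSum (k.val + 1) v ≤ |v k| →
        ν (Function.update v k 0) ^ p + κ * |v k| ^ p ≤ ν v ^ p) →
      (∀ n, a (n + 1) = Function.update (a n) (idx n) (a (n + 1) (idx n))) →
      (∀ n j s, ν (a (n + 1)) ≤ ν (Function.update (a n) j s)) →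
      ∃ n ≤ N, a n = 0 := by
  set D : ℝ := (1 + K) ^ m with hD
  have hD1 : 1 ≤ D := one_le_pow₀ (by linarith)
  have hD0 : 0 < D := by linarith
  have hDp : 1 ≤ D ^ p := Real.one_le_rpow hD1 hp.le
  have hbase : 0 ≤ 1 - κ / D ^ p := by
    rw [sub_nonneg, div_le_one (by positivity)]
    linarith
  have hbase1 : 1 - κ / D ^ p < 1 := by
    have : 0 < κ / D ^ p := by positivity
    linarith
  have hroot : ∀ {x y : ℝ}, 0 ≤ x → 0 ≤ y → x ^ p ≤ y ^ p → x ≤ y := fun hx hy h =>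
    (Real.rpow_le_rpow_iff hx hy hp).1 h
  obtain ⟨N, hN⟩ := exists_bound_eq_zero_of_contracting m
    (B := D * (κ⁻¹) ^ (p⁻¹)) (K := K) (ρ := (1 - κ / D ^ p) ^ (p⁻¹)) (by positivity) hK
    (by positivity) (Real.rpow_lt_one hbase hbase1 (by positivity))
  refine ⟨N, fun ν a idx h0 h1 h2 h3 h4 h5 => hN ν a idx h1 ?_ h2 h4 ?_ ?_⟩
  · intro v
    obtain ⟨j, hj, hj'⟩ := exists_dominant_coord hm hK v
    have h := h3 v j hj
    have h' : 0 ≤ ν (Function.update v j 0) ^ p := Real.rpow_nonneg (h0 _) _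
    have : |v j| ≤ κ⁻¹ ^ p⁻¹ * ν v := by
      refine hroot (abs_nonneg _) (mul_nonneg (by positivity) (h0 _)) ?_
      rw [Real.mul_rpow (by positivity) (h0 _), ← Real.rpow_mul (by positivity),
        inv_mul_cancel₀ hp.ne', Real.rpow_one, le_inv_mul_iff₀ hκ]
      linarith
    calc tailSum 0 v ≤ D * |v j| := hj'
      _ ≤ D * (κ⁻¹ ^ p⁻¹ * ν v) := by gcongr
      _ = _ := by ring
  · intro n
    obtain ⟨j, hj, hj'⟩ := exists_dominant_coord hm hK (a n)
    have h := h3 (a n) j hj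
    refine (h5 n j 0).trans (hroot (h0 _) (mul_nonneg (by positivity) (h0 _)) ?_)
    rw [Real.mul_rpow (by positivity) (h0 _), ← Real.rpow_mul hbase,
      inv_mul_cancel₀ hp.ne', Real.rpow_one]
    have h6 : ν (a n) ^ p ≤ D ^ p * |a n j| ^ p := by
      rw [← Real.mul_rpow hD0.le (abs_nonneg _)]
      exact Real.rpow_le_rpow (h0 _) ((h1 _).trans hj') hp.le
    have h7 : κ / D ^ p * ν (a n) ^ p ≤ κ * |a n j| ^ p := by
      rw [div_mul_eq_mul_div, div_le_iff₀ (by positivity)]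
      nlinarith
    linarith
  · intro n
    by_contra! hcon
    have htail : tailSum (idx n + 1) (a (n + 1)) = tailSum (idx n + 1) (a n) := by
      rw [h4, tailSum_update_of_lt _ (Nat.lt_succ_self _)]
    have h := h3 (a (n + 1)) (idx n) (by rw [htail]; exact hcon.le)
    have hup : Function.update (a (n + 1)) (idx n) 0 = Function.update (a n) (idx n) 0 := by
      rw [h4, Function.update_idem]
    rw [hup] at h
    have h6 := Real.rpow_le_rpow (h0 _) (h5 n (idx n) 0) hp.le
    have h7 : 0 < |a (n + 1) (idx n)| :=
      lt_of_le_of_lt (mul_nonneg (by linarith) (tailSum_nonneg _ _)) hcon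
    have h8 : 0 < κ * |a (n + 1) (idx n)| ^ p := by positivity
    linarith

/-- Suppressing the component of a Haar expansion along `haarFnP p k` decreases the norm
substantially when that component dominates all the later ones. -/
lemma exists_integral_add_le {p : ℝ} (hp : 2 < p) :
    ∃ K κ : ℝ, 1 ≤ K ∧ 0 < κ ∧ κ ≤ 1 ∧
      ∀ {ι : Type} (k : ℕ) (y : ℝ → ℝ) (b : ℝ) (J : Finset ι) (σ : ι → ℕ) (a : ι → ℝ),
        IsSimple y → (k = 0 → y = 0) →
        (∀ j, k ≤ j → ∀ s t, haarFn j s ≠ 0 → haarFn j t ≠ 0 → y s = y t) →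
        (∀ j ∈ J, k < σ j) → K * ∑ j ∈ J, |a j| ≤ |b| →
        (∫ t in Set.Ico (0 : ℝ) 1, |y t + ∑ j ∈ J, a j * haarFnP p (σ j) t| ^ p) + κ * |b| ^ p ≤
          ∫ t in Set.Ico (0 : ℝ) 1,
            |y t + b * haarFnP p k t + ∑ j ∈ J, a j * haarFnP p (σ j) t| ^ p := by
  obtain ⟨κ, hκ, C, hC, hbd⟩ := exists_bounds_abs_add_rpow hp
  have hp0 : 0 < p := by linarith
  refine ⟨1 + 2 * C / κ, min (κ / 2) 1, le_add_of_nonneg_right (by positivity), by positivity, min_le_right _ _, ?_⟩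
  intro ι k y b J σ a hy hy0 hyc hσ hb
  set e := haarFnP p k with he
  set z : ℝ → ℝ := fun t => ∑ j ∈ J, a j * haarFnP p (σ j) t with hz
  set w : ℝ → ℝ := fun t => |haarFn k t| with hw
  set φ : ℝ → ℝ := fun u => |u| ^ (p - 2) * u with hφ
  set τ := ∑ j ∈ J, |a j| with hτ
  set Q := haarMass k ^ (1 - 2 / p) with hQ
  have hτ0 : 0 ≤ τ := Finset.sum_nonneg fun _ _ => abs_nonneg _
  have hQ0 : 0 ≤ Q := Real.rpow_nonneg (haarMass_pos k).le _
  obtain ⟨γ, hγ0, hγ⟩ : ∃ γ : ℝ, 0 ≤ γ ∧ ∀ t, haarFn k t ≠ 0 → |y t| ^ (p - 2) = γ := by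
    by_cases h : ∃ s, haarFn k s ≠ 0
    · obtain ⟨s, hs⟩ := h
      exact ⟨|y s| ^ (p - 2), by positivity, fun t ht => by rw [hyc k le_rfl t s ht hs]⟩
    · exact ⟨0, le_rfl, fun t ht => absurd ⟨t, ht⟩ h⟩
  have hes : IsSimple e := isSimple_haarFnP p k
  have hzs : IsSimple z := IsSimple.sum J fun j _ => (isSimple_haarFnP p (σ j)).const_mul (a j)
  have hws : IsSimple w := (isSimple_haarFn k).comp fun u => |u|
  set g : ℝ → ℝ := fun t => w t * (φ (y t + b * e t) - φ (y t)) with hg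
  have hgs : IsSimple g := hws.mul (((hy.add (hes.const_mul b)).comp φ).sub (hy.comp φ))
  have hpt : ∀ t, |y t + z t| ^ p + (p * b) * (φ (y t) * e t) + p * (g t * z t) +
      κ * (γ * b ^ 2) * |e t| ^ (2 : ℝ) + κ * |b| ^ p * |e t| ^ p -
      C * γ * (w t * |z t| ^ (2 : ℝ)) - C * (w t * |z t| ^ p) ≤
      |y t + b * e t + z t| ^ p := by
    intro t
    simp only [Real.rpow_two, sq_abs]
    rcases haarFn_values k t with h | h
    · have h1 : e t = 0 := haarFnP_eq_zero h
      have h2 : w t = 0 := by simp [hw, h]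
      simp [hg, h1, h2, Real.zero_rpow hp0.ne']
    · have h1 : haarFn k t ≠ 0 := fun h' => by simp [h'] at h
      have h2 : w t = 1 := h
      have l1 := (hbd (y t + b * e t) (z t)).1
      have l2 := (hbd (y t) (b * e t)).1
      have l3 := (hbd (y t) (z t)).2
      have l4 : 0 ≤ κ * (|y t + b * e t| ^ (p - 2) * z t ^ 2 + |z t| ^ p) := by positivity
      rw [hγ t h1, abs_mul, Real.mul_rpow (abs_nonneg _) (abs_nonneg _), mul_pow] at l2
      rw [hγ t h1] at l3
      simp only [hg, h2, hφ, hγ t h1]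
      linarith
  have horth : ∫ t in Set.Ico (0 : ℝ) 1, φ (y t) * e t = 0 := by
    rcases eq_or_ne k 0 with hk | hk
    · simp [hy0 hk, hφ]
    · exact integral_mul_haarFnP_eq_zero p hk fun s t hs ht => by rw [hyc k le_rfl s t hs ht]
  have horth' : ∫ t in Set.Ico (0 : ℝ) 1, g t * z t = 0 := by
    have hsplit : ∀ t, g t * z t = ∑ j ∈ J, a j * (g t * haarFnP p (σ j) t) := by
      intro t
      simp only [hz, Finset.mul_sum, mul_left_comm]
    simp only [hsplit]
    rw [integral_finsetSum _ fun j _ =>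
      ((hgs.mul (isSimple_haarFnP p (σ j))).const_mul (a j)).integrable _]
    refine Finset.sum_eq_zero fun j hj => ?_
    have hkj := hσ j hj
    rw [integral_const_mul, integral_mul_haarFnP_eq_zero p (by omega), mul_zero]
    intro s t hs ht
    simp only [hg, hw, he, haarFnP, hyc (σ j) hkj.le s t hs ht, haarFn_eq_of_lt hkj hs ht]
  have hint : (∫ t in Set.Ico (0 : ℝ) 1, |y t + z t| ^ p) + κ * (γ * b ^ 2) * Q + κ * |b| ^ p -
      C * γ * (∫ t in Set.Ico (0 : ℝ) 1, w t * |z t| ^ (2 : ℝ)) -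
      C * (∫ t in Set.Ico (0 : ℝ) 1, w t * |z t| ^ p) ≤
      ∫ t in Set.Ico (0 : ℝ) 1, |y t + b * e t + z t| ^ p := by
    have s1 := (hy.add hzs).abs_rpow p
    have s2 := ((hy.comp φ).mul hes).const_mul (p * b)
    have s3 := (hgs.mul hzs).const_mul p
    have s4 := (hes.abs_rpow 2).const_mul (κ * (γ * b ^ 2))
    have s5 := (hes.abs_rpow p).const_mul (κ * |b| ^ p)
    have s6 := (hws.mul (hzs.abs_rpow 2)).const_mul (C * γ)
    have s7 := (hws.mul (hzs.abs_rpow p)).const_mul C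
    have t2 := s1.add s2
    have t3 := t2.add s3
    have t4 := t3.add s4
    have t5 := t4.add s5
    have t6 := t5.sub s6
    have hmono := integral_mono (μ := volume.restrict (Set.Ico (0 : ℝ) 1))
      ((t6.sub s7).integrable _)
      ((((hy.add (hes.const_mul b)).add hzs).abs_rpow p).integrable _) hpt
    rw [integral_sub (t6.integrable _) (s7.integrable _),
      integral_sub (t5.integrable _) (s6.integrable _),
      integral_add (t4.integrable _) (s5.integrable _),
      integral_add (t3.integrable _) (s4.integrable _),
      integral_add (t2.integrable _) (s3.integrable _),
      integral_add (s1.integrable _) (s2.integrable _)] at hmono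
    simp only [integral_const_mul] at hmono
    rw [horth, horth', integral_abs_haarFnP_rpow hp0 two_pos,
      integral_abs_haarFnP_rpow hp0 hp0, div_self hp0.ne', sub_self, Real.rpow_zero] at hmono
    linarith
  have hz2 : ∫ t in Set.Ico (0 : ℝ) 1, w t * |z t| ^ (2 : ℝ) ≤ τ ^ (2 : ℝ) * Q :=
    integral_abs_haarFn_mul_sum_le one_le_two hp.le J σ hσ a
  have hzp : ∫ t in Set.Ico (0 : ℝ) 1, w t * |z t| ^ p ≤ τ ^ p := by
    have := integral_abs_haarFn_mul_sum_le (p := p) (q := p) (by linarith) le_rfl J σ hσ a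
    rwa [div_self hp0.ne', sub_self, Real.rpow_zero, mul_one] at this
  have hR : ∀ q : ℝ, 1 ≤ q → C * τ ^ q ≤ κ / 2 * |b| ^ q := by
    intro q hq
    have h2C : 0 < 2 * C / κ := by positivity
    have hK : (1 + 2 * C / κ) ^ (1 : ℝ) ≤ (1 + 2 * C / κ) ^ q :=
      Real.rpow_le_rpow_of_exponent_le (by linarith) hq
    rw [Real.rpow_one] at hK
    have h1 := Real.rpow_le_rpow (by positivity) hb (by linarith : 0 ≤ q)
    rw [Real.mul_rpow (by positivity) hτ0] at h1
    have hτq : 0 ≤ τ ^ q := by positivity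
    have h2 : 2 * C / κ * τ ^ q ≤ |b| ^ q :=
      (mul_le_mul_of_nonneg_right (by linarith) hτq).trans h1
    calc C * τ ^ q = κ / 2 * (2 * C / κ * τ ^ q) := by field_simp
      _ ≤ _ := by gcongr
  have hR2 := hR 2 one_le_two
  have hRp := hR p (by linarith)
  rw [Real.rpow_two, Real.rpow_two, sq_abs] at hR2
  rw [Real.rpow_two] at hz2
  have f1 : C * γ * (∫ t in Set.Ico (0 : ℝ) 1, w t * |z t| ^ (2 : ℝ)) ≤
      κ * (γ * b ^ 2) * Q := by
    calc C * γ * (∫ t in Set.Ico (0 : ℝ) 1, w t * |z t| ^ (2 : ℝ))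
        ≤ C * γ * (τ ^ 2 * Q) := by gcongr
      _ = γ * Q * (C * τ ^ 2) := by ring
      _ ≤ γ * Q * (κ / 2 * b ^ 2) := by gcongr
      _ ≤ _ := by
        have : 0 ≤ κ * (γ * b ^ 2) * Q := by positivity
        linarith
  have f2 : C * (∫ t in Set.Ico (0 : ℝ) 1, w t * |z t| ^ p) ≤ κ / 2 * |b| ^ p :=
    (mul_le_mul_of_nonneg_left hzp hC.le).trans hRp
  have f3 : min (κ / 2) 1 * |b| ^ p ≤ κ / 2 * |b| ^ p :=
    mul_le_mul_of_nonneg_right (min_le_left _ _) (by positivity)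
  linarith

/-- The Haar polynomial with coefficients `v` along the functions `haarFnP p (σ i)`. -/
noncomputable def haarSum (p : ℝ) {m : ℕ} (σ : Fin m → ℕ) (v : Fin m → ℝ) : ℝ → ℝ :=
  fun t => ∑ i, v i * haarFnP p (σ i) t

lemma isSimple_haarSum (p : ℝ) {m : ℕ} (σ : Fin m → ℕ) (v : Fin m → ℝ) :
    IsSimple (haarSum p σ v) :=
  IsSimple.sum _ fun i _ => (isSimple_haarFnP p (σ i)).const_mul (v i)

lemma haarSum_update (p : ℝ) {m : ℕ} (σ : Fin m → ℕ) (v : Fin m → ℝ) (i : Fin m) (s : ℝ) :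
    haarSum p σ (Function.update v i s) =
      fun t => haarSum p σ v t - (v i - s) * haarFnP p (σ i) t := by
  funext t
  unfold haarSum
  rw [← Finset.add_sum_erase _ _ (Finset.mem_univ i),
    ← Finset.add_sum_erase _ (fun i => v i * _) (Finset.mem_univ i), Function.update_self,
    Finset.sum_congr rfl fun j hj => by rw [Function.update_of_ne (Finset.ne_of_mem_erase hj)]]
  ring

lemma pnorm_haarSum_le {p : ℝ} (hp : 1 ≤ p) {m : ℕ} (σ : Fin m → ℕ) (v : Fin m → ℝ) :
    pnorm p (haarSum p σ v) ≤ tailSum 0 v := by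
  have key : ∀ J : Finset (Fin m), pnorm p (fun t => ∑ i ∈ J, v i * haarFnP p (σ i) t) ≤
      ∑ i ∈ J, |v i| := by
    intro J
    induction J using Finset.induction_on with
    | empty => simp [pnorm_zero]
    | insert i J hi ih =>
      simp only [Finset.sum_insert hi]
      refine (pnorm_add_le hp ((isSimple_haarFnP p (σ i)).const_mul (v i))
        (IsSimple.sum J fun j _ => (isSimple_haarFnP p (σ j)).const_mul (v j))).trans ?_
      rw [pnorm_const_mul, pnorm_haarFnP (by linarith), mul_one]
      gcongr
  unfold haarSum tailSum
  simpa using key Finset.univ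

lemma pnorm_haarSum_le_update {p : ℝ} (hp : 1 ≤ p) {m : ℕ} (σ : Fin m → ℕ) (v : Fin m → ℝ)
    (i : Fin m) (s : ℝ) :
    pnorm p (haarSum p σ v) ≤ pnorm p (haarSum p σ (Function.update v i s)) + |v i - s| := by
  have h := pnorm_add_le hp (isSimple_haarSum p σ (Function.update v i s))
    ((isSimple_haarFnP p (σ i)).const_mul (v i - s))
  rw [pnorm_const_mul, pnorm_haarFnP (by linarith), mul_one] at h
  convert h using 2
  rw [haarSum_update]
  funext t
  ring

lemma haarSum_eq_add {p : ℝ} {m : ℕ} (σ : Fin m → ℕ) (v : Fin m → ℝ) (k : Fin m) (t : ℝ) :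
    haarSum p σ v t = ∑ i with i < k, v i * haarFnP p (σ i) t + v k * haarFnP p (σ k) t +
      ∑ i with k.val + 1 ≤ i.val, v i * haarFnP p (σ i) t := by
  have hk : v k * haarFnP p (σ k) t = ∑ i, if i = k then v i * haarFnP p (σ i) t else 0 := by
    simp
  rw [hk, Finset.sum_filter, Finset.sum_filter, ← Finset.sum_add_distrib,
    ← Finset.sum_add_distrib]
  refine Finset.sum_congr rfl fun i _ => ?_
  rcases lt_trichotomy i k with h | h | h
  · have h' : ¬ k.val + 1 ≤ i.val := by rw [Fin.lt_def] at h; omega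
    simp [h, h.ne, h']
  · simp [h]
  · have h' : k.val + 1 ≤ i.val := h
    simp [h.ne', h', h.not_gt]

/-- Coefficient form of `exists_integral_add_le`. -/
lemma exists_pnorm_update_le {p : ℝ} (hp : 2 < p) :
    ∃ K κ : ℝ, 1 ≤ K ∧ 0 < κ ∧ κ ≤ 1 ∧
      ∀ {m : ℕ} (σ : Fin m → ℕ) (_ : StrictMono σ) (v : Fin m → ℝ) (k : Fin m),
        K * tailSum (k.val + 1) v ≤ |v k| →
        pnorm p (haarSum p σ (Function.update v k 0)) ^ p + κ * |v k| ^ p ≤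
          pnorm p (haarSum p σ v) ^ p := by
  obtain ⟨K, κ, hK, hκ, hκ1, h⟩ := exists_integral_add_le hp
  refine ⟨K, κ, hK, hκ, hκ1, fun {m} σ hσ v k hv => ?_⟩
  have hp0 : 0 < p := by linarith
  rw [pnorm_rpow hp0 (isSimple_haarSum _ _ _), pnorm_rpow hp0 (isSimple_haarSum _ _ _)]
  have h' := h (σ k) (fun t => ∑ i with i < k, v i * haarFnP p (σ i) t) (v k)
    (Finset.univ.filter fun i : Fin m => k.val + 1 ≤ i.val) σ v
    (IsSimple.sum _ fun i _ => (isSimple_haarFnP p (σ i)).const_mul (v i)) ?_ ?_ ?_ hv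
  · convert h' using 6 with t t
    · rw [haarSum_update]
      simp only [haarSum_eq_add σ v k]
      ring
    · rw [haarSum_eq_add σ v k]
  · intro hk0
    funext t
    refine Finset.sum_eq_zero fun i hi => ?_
    have := hσ (Finset.mem_filter.1 hi).2
    omega
  · intro j hj s t hs ht
    refine Finset.sum_congr rfl fun i hi => ?_
    have := hσ (Finset.mem_filter.1 hi).2
    rw [haarFnP, haarFnP, haarFn_eq_of_lt (by omega) hs ht]
  · intro j hj
    exact hσ (Fin.lt_def.2 (Finset.mem_filter.1 hj).2)

/-- for `2 < p < ∞` and `m ≥ 1` there is a positive integer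
`N = N(p,m)` such that for every `m`-element subset `A ⊂ ℕ`, every XGA residual
sequence for the dictionary `{h_i^{(p)} : i ∈ A}` in `L_p[0,1]`, starting at any
vector of the linear span of the dictionary, satisfies `x_N = 0`. -/
theorem stmt_19 (p : ℝ) (hp : 2 < p) (m : ℕ) (hm : 1 ≤ m) :
    ∃ N : ℕ, 0 < N ∧
      ∀ A : Finset ℕ, A.card = m →
        ∀ (c : ℕ → ℝ) (x : ℕ → ℝ → ℝ),
          x 0 = (fun t => ∑ i ∈ A, c i * haarFnP p i t) →
          (∀ n : ℕ,
            (x n ≠ 0 → ∃ i ∈ A, ∃ lam : ℝ,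
              x (n + 1) = (fun t => x n t - lam * haarFnP p i t) ∧
              ∀ j ∈ A, ∀ t : ℝ,
                pnorm p (fun s => x n s - lam * haarFnP p i s) ≤
                  pnorm p (fun s => x n s - t * haarFnP p j s)) ∧
            (x n = 0 → x (n + 1) = 0)) →
          x N = 0 := by
  obtain ⟨K, κ, hK, hκ, hκ1, hdom⟩ := exists_pnorm_update_le hp
  obtain ⟨N, hN⟩ := exists_bound_greedy_eq_zero hm hK hκ hκ1 (show 0 < p by linarith)
  refine ⟨N + 1, N.succ_pos, fun A hA c x hx0 hx => ?_⟩
  set σ : Fin m ↪o ℕ := A.orderEmbOfFin hA with hσ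
  have hσA : ∀ i, σ i ∈ A := fun i => A.orderEmbOfFin_mem hA i
  have hAσ : ∀ j ∈ A, ∃ i, σ i = j := by
    intro j hj
    have : j ∈ Set.range σ := by rw [hσ, A.range_orderEmbOfFin hA]; exact hj
    exact this
  have hstep : ∀ n, ∃ (i : Fin m) (lam : ℝ),
      x (n + 1) = (fun t => x n t - lam * haarFnP p (σ i) t) ∧
      ∀ (j : Fin m) (s : ℝ), pnorm p (x (n + 1)) ≤
        pnorm p (fun t => x n t - s * haarFnP p (σ j) t) := by
    intro n
    by_cases h0 : x n = 0
    · have h1 := (hx n).2 h0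
      refine ⟨⟨0, hm⟩, 0, by simp [h1, h0]; rfl, fun j s => ?_⟩
      rw [h1]
      exact (pnorm_zero p).le.trans (pnorm_nonneg _ _)
    · obtain ⟨i, hi, lam, h1, h2⟩ := (hx n).1 h0
      obtain ⟨i, rfl⟩ := hAσ i hi
      exact ⟨i, lam, h1, fun j s => by rw [h1]; exact h2 _ (hσA j) s⟩
  choose idx lam hidx hmin using hstep
  obtain ⟨a, ha0, ha⟩ : ∃ a : ℕ → Fin m → ℝ, (a 0 = fun i => c (σ i)) ∧
      ∀ n, a (n + 1) = Function.update (a n) (idx n) (a n (idx n) - lam n) :=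
    ⟨fun n => Nat.rec (fun i => c (σ i))
      (fun n v => Function.update v (idx n) (v (idx n) - lam n)) n, rfl, fun _ => rfl⟩
  have hxa : ∀ n, x n = haarSum p σ (a n) := by
    intro n
    induction n with
    | zero =>
      rw [hx0]
      funext t
      have : A = Finset.univ.map σ.toEmbedding := by
        ext j
        simp only [Finset.mem_map, Finset.mem_univ, true_and]
        exact ⟨hAσ j, fun ⟨i, hi⟩ => hi ▸ hσA i⟩
      rw [haarSum, ha0, this, Finset.sum_map]
      rfl
    | succ n ih =>
      rw [ha, haarSum_update, ← ih, hidx n]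
      funext t
      ring
  obtain ⟨n, hn, hn0⟩ := hN (fun v => pnorm p (haarSum p σ v)) a idx
    (fun v => pnorm_nonneg _ _) (pnorm_haarSum_le (by linarith) σ)
    (pnorm_haarSum_le_update (by linarith) σ) (hdom σ σ.strictMono)
    (fun n => by rw [ha, Function.update_self])
    (fun n j s => by
      rw [← hxa, haarSum_update, ← hxa]
      exact hmin n j _)
  have hzero : x n = 0 := by
    rw [hxa, hn0]
    funext t
    simp [haarSum]
  have hlater : ∀ d, x (n + d) = 0 := by
    intro d
    induction d with
    | zero => exact hzero
    | succ d ih => exact (hx _).2 ih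
  obtain ⟨d, hd⟩ := Nat.exists_eq_add_of_le (show n ≤ N + 1 by omega)
  rw [hd]
  exact hlater d
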